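/- Let d ≥ 1, β > 0, and let h ∈ (ℝ^d)^ℕ be a field whose sample means converge, m_n → m ∈ ℝ^d, and whose sample standard deviations converge, s_n → s ∈ (0,∞)^d. Then liminf_{n→∞} (1/n) ln ∫_{B_{2d}(0,1)} (1 − ‖x‖² − ‖y‖²)^{−(d+1)} e^{n ψ_n^{β,h}(x,y)} dx dy ≥ sup_{(x,y) ∈ B_{2d}(0,1)} ψ^{β,h}(x,y). -/

import Mathlib

open MeasureTheory Filter Topology

noncomputable def ip {d : ℕ} (x y : Fin d → ℝ) : ℝ := ∑ j, x j * y j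

noncomputable def sampleMean (d : ℕ) (h : ℕ → Fin d → ℝ) (n : ℕ) : Fin d → ℝ :=
  fun j => (∑ i ∈ Finset.range n, h i j) / n

noncomputable def sampleStd (d : ℕ) (h : ℕ → Fin d → ℝ) (n : ℕ) : Fin d → ℝ :=
  fun j => Real.sqrt ((∑ i ∈ Finset.range n, (h i j) ^ 2) / n - (sampleMean d h n j) ^ 2)

/-- Membership in the open unit ball `B_{2d}(0,1) ⊂ ℝ^d × ℝ^d`. -/
def inBall (d : ℕ) (x y : Fin d → ℝ) : Prop := ip x x + ip y y < 1

def ballSet (d : ℕ) : Set ((Fin d → ℝ) × (Fin d → ℝ)) := {p | inBall d p.1 p.2}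

/-- The exponential tilting function with mean vector `m` and standard deviation vector `s`. -/
noncomputable def psi (d : ℕ) (β : ℝ) (m s : Fin d → ℝ) (x y : Fin d → ℝ) : ℝ :=
  β / 2 * ip x x + β * ip m x + β * ip s y + (d : ℝ) / 2 * Real.log (1 - ip x x - ip y y)

theorem continuous_ip {d : ℕ} :
    Continuous (fun q : (Fin d → ℝ) × (Fin d → ℝ) => ip q.1 q.2) := by
  unfold ip
  fun_prop

theorem ip_self_nonneg {d : ℕ} (x : Fin d → ℝ) : 0 ≤ ip x x :=
  Finset.sum_nonneg fun j _ => mul_self_nonneg (x j)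

theorem sq_le_ip_self {d : ℕ} (x : Fin d → ℝ) (j : Fin d) : x j * x j ≤ ip x x :=
  Finset.single_le_sum (f := fun j => x j * x j) (fun j _ => mul_self_nonneg (x j))
    (Finset.mem_univ j)

theorem abs_le_one_of_ip_self_le_one {d : ℕ} {x : Fin d → ℝ} (hx : ip x x ≤ 1) (j : Fin d) :
    |x j| ≤ 1 :=
  abs_le_one_iff_mul_self_le_one.2 ((sq_le_ip_self x j).trans hx)

theorem ip_le_sum_abs {d : ℕ} (a : Fin d → ℝ) {x : Fin d → ℝ} (hx : ip x x ≤ 1) :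
    ip a x ≤ ∑ j, |a j| := by
  refine Finset.sum_le_sum fun j _ => (le_abs_self _).trans ?_
  rw [abs_mul]
  exact mul_le_of_le_one_right (abs_nonneg _) (abs_le_one_of_ip_self_le_one hx j)

theorem isOpen_ballSet (d : ℕ) : IsOpen (ballSet d) := by
  have h1 : Continuous fun p : (Fin d → ℝ) × (Fin d → ℝ) => ip p.1 p.1 + ip p.2 p.2 :=
    (continuous_ip.comp (continuous_fst.prodMk continuous_fst)).add
      (continuous_ip.comp (continuous_snd.prodMk continuous_snd))
  exact isOpen_lt h1 continuous_const

theorem zero_mem_ballSet (d : ℕ) : (0 : (Fin d → ℝ) × (Fin d → ℝ)) ∈ ballSet d := by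
  simp [ballSet, inBall, ip]

theorem ip_le_one_of_mem_ballSet {d : ℕ} {p : (Fin d → ℝ) × (Fin d → ℝ)} (hp : p ∈ ballSet d) :
    ip p.1 p.1 ≤ 1 ∧ ip p.2 p.2 ≤ 1 := by
  have h : ip p.1 p.1 + ip p.2 p.2 < 1 := hp
  constructor <;> linarith [ip_self_nonneg p.1, ip_self_nonneg p.2]

theorem ballSet_subset_closedBall (d : ℕ) : ballSet d ⊆ Metric.closedBall 0 1 := by
  intro p hp
  obtain ⟨h1, h2⟩ := ip_le_one_of_mem_ballSet hp
  rw [mem_closedBall_zero_iff, Prod.norm_def, max_le_iff, pi_norm_le_iff_of_nonneg zero_le_one,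
    pi_norm_le_iff_of_nonneg zero_le_one]
  exact ⟨abs_le_one_of_ip_self_le_one h1, abs_le_one_of_ip_self_le_one h2⟩

theorem volume_ballSet_lt_top (d : ℕ) : volume (ballSet d) < ⊤ :=
  (measure_mono (ballSet_subset_closedBall d)).trans_lt
    (isCompact_closedBall _ _).measure_lt_top

/-- The tilted density `(1 - ‖x‖² - ‖y‖²)^{-(d+1)} e^{n ψ(x,y)}`. -/
noncomputable def tiltedDensity (d : ℕ) (β : ℝ) (m s : Fin d → ℝ) (n : ℕ)
    (p : (Fin d → ℝ) × (Fin d → ℝ)) : ℝ :=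
  Real.exp (n * psi d β m s p.1 p.2) / (1 - ip p.1 p.1 - ip p.2 p.2) ^ (d + 1)

theorem measurable_tiltedDensity (d : ℕ) (β : ℝ) (m s : Fin d → ℝ) (n : ℕ) :
    Measurable (tiltedDensity d β m s n) := by
  have hip (f g : (Fin d → ℝ) × (Fin d → ℝ) → Fin d → ℝ) (hf : Continuous f)
      (hg : Continuous g) : Measurable fun p => ip (f p) (g p) :=
    (continuous_ip.comp (hf.prodMk hg)).measurable
  have h1 := hip _ _ continuous_fst continuous_fst
  have h2 := hip _ _ continuous_snd continuous_snd
  have h3 := hip _ _ (continuous_const (y := m)) continuous_fst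
  have h4 := hip _ _ (continuous_const (y := s)) continuous_snd
  unfold tiltedDensity psi
  fun_prop

theorem exp_le_tiltedDensity {d : ℕ} (β : ℝ) (m s : Fin d → ℝ) (n : ℕ)
    {p : (Fin d → ℝ) × (Fin d → ℝ)} (hp : p ∈ ballSet d) :
    Real.exp (n * psi d β m s p.1 p.2) ≤ tiltedDensity d β m s n p := by
  have h : ip p.1 p.1 + ip p.2 p.2 < 1 := hp
  have h1 := ip_self_nonneg p.1
  have h2 := ip_self_nonneg p.2
  exact le_div_self (Real.exp_pos _).le (pow_pos (by linarith) _)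
    (pow_le_one₀ (by linarith) (by linarith))

theorem tiltedDensity_le {d : ℕ} (hd : 1 ≤ d) {β : ℝ} (hβ : 0 ≤ β) (m s : Fin d → ℝ) {n : ℕ}
    (hn : 4 ≤ n) {p : (Fin d → ℝ) × (Fin d → ℝ)} (hp : p ∈ ballSet d) :
    tiltedDensity d β m s n p ≤
      Real.exp (n * (β / 2 + β * ∑ j, |m j| + β * ∑ j, |s j|)) := by
  have h : ip p.1 p.1 + ip p.2 p.2 < 1 := hp
  have h1 := ip_self_nonneg p.1
  have h2 := ip_self_nonneg p.2
  obtain ⟨h3, h4⟩ := ip_le_one_of_mem_ballSet hp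
  have h5 := mul_le_mul_of_nonneg_left (ip_le_sum_abs m h3) hβ
  have h6 := mul_le_mul_of_nonneg_left (ip_le_sum_abs s h4) hβ
  have h7 : β / 2 * ip p.1 p.1 ≤ β / 2 := mul_le_of_le_one_right (by linarith) h3
  have ht : 0 < 1 - ip p.1 p.1 - ip p.2 p.2 := by linarith
  have hlog : Real.log (1 - ip p.1 p.1 - ip p.2 p.2) ≤ 0 :=
    Real.log_nonpos ht.le (by linarith)
  have hpow : (1 - ip p.1 p.1 - ip p.2 p.2) ^ (d + 1) =
      Real.exp ((d + 1 : ℕ) * Real.log (1 - ip p.1 p.1 - ip p.2 p.2)) := by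
    rw [Real.exp_nat_mul, Real.exp_log ht]
  have hd' : (1 : ℝ) ≤ d := by exact_mod_cast hd
  have hn' : (4 : ℝ) ≤ n := by exact_mod_cast hn
  have hcoef : (0 : ℝ) ≤ n * (d / 2) - (d + 1) := by nlinarith
  have h8 := mul_nonpos_of_nonneg_of_nonpos hcoef hlog
  have h9 := mul_le_mul_of_nonneg_left (add_le_add (add_le_add h7 h5) h6)
    (Nat.cast_nonneg (α := ℝ) n)
  rw [tiltedDensity, hpow, ← Real.exp_sub, Real.exp_le_exp, psi]
  push_cast
  linarith

theorem tiltedDensity_nonneg {d : ℕ} (β : ℝ) (m s : Fin d → ℝ) (n : ℕ)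
    {p : (Fin d → ℝ) × (Fin d → ℝ)} (hp : p ∈ ballSet d) : 0 ≤ tiltedDensity d β m s n p :=
  (Real.exp_pos _).le.trans (exp_le_tiltedDensity β m s n hp)

theorem integrableOn_tiltedDensity {d : ℕ} (hd : 1 ≤ d) {β : ℝ} (hβ : 0 ≤ β) (m s : Fin d → ℝ)
    {n : ℕ} (hn : 4 ≤ n) : IntegrableOn (tiltedDensity d β m s n) (ballSet d) := by
  refine Measure.integrableOn_of_bounded (volume_ballSet_lt_top d).ne
    (measurable_tiltedDensity d β m s n).aestronglyMeasurable
    (M := Real.exp (n * (β / 2 + β * ∑ j, |m j| + β * ∑ j, |s j|))) ?_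
  filter_upwards [ae_restrict_mem (isOpen_ballSet d).measurableSet] with p hp
  rw [Real.norm_of_nonneg (tiltedDensity_nonneg β m s n hp)]
  exact tiltedDensity_le hd hβ m s hn hp

theorem volume_real_mul_exp_le_integral {d : ℕ} (hd : 1 ≤ d) {β : ℝ} (hβ : 0 ≤ β)
    (m s : Fin d → ℝ) {n : ℕ} (hn : 4 ≤ n) {U : Set ((Fin d → ℝ) × (Fin d → ℝ))}
    (hU : MeasurableSet U) (hUb : U ⊆ ballSet d) {c : ℝ}
    (hc : ∀ p ∈ U, c ≤ psi d β m s p.1 p.2) :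
    volume.real U * Real.exp (n * c) ≤ ∫ p in ballSet d, tiltedDensity d β m s n p := by
  have hint := integrableOn_tiltedDensity hd hβ m s hn
  have hfin : volume U ≠ ⊤ := ((measure_mono hUb).trans_lt (volume_ballSet_lt_top d)).ne
  calc volume.real U * Real.exp (n * c) = ∫ _ in U, Real.exp (n * c) := by
        rw [setIntegral_const, smul_eq_mul]
    _ ≤ ∫ p in U, tiltedDensity d β m s n p := by
        refine setIntegral_mono_on (integrableOn_const hfin) (hint.mono_set hUb) hU fun p hp => ?_
        refine le_trans (Real.exp_le_exp.2 ?_) (exp_le_tiltedDensity β m s n (hUb hp))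
        exact mul_le_mul_of_nonneg_left (hc p hp) (Nat.cast_nonneg n)
    _ ≤ ∫ p in ballSet d, tiltedDensity d β m s n p := by
        refine setIntegral_mono_set hint ?_ hUb.eventuallyLE
        filter_upwards [ae_restrict_mem (isOpen_ballSet d).measurableSet] with p hp
        exact tiltedDensity_nonneg β m s n hp

theorem integral_tiltedDensity_le {d : ℕ} (hd : 1 ≤ d) {β : ℝ} (hβ : 0 ≤ β)
    (m s : Fin d → ℝ) {n : ℕ} (hn : 4 ≤ n) :
    ∫ p in ballSet d, tiltedDensity d β m s n p ≤ volume.real (ballSet d) *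
      Real.exp (n * (β / 2 + β * ∑ j, |m j| + β * ∑ j, |s j|)) := by
  rw [← smul_eq_mul, ← setIntegral_const]
  exact setIntegral_mono_on (integrableOn_tiltedDensity hd hβ m s hn)
    (integrableOn_const (volume_ballSet_lt_top d).ne) (isOpen_ballSet d).measurableSet
    fun p hp => tiltedDensity_le hd hβ m s hn hp

theorem volume_real_pos_of_isOpen_of_subset_ballSet {d : ℕ}
    {U : Set ((Fin d → ℝ) × (Fin d → ℝ))} (hU : IsOpen U) (hne : U.Nonempty)
    (hUb : U ⊆ ballSet d) : 0 < volume.real U :=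
  ENNReal.toReal_pos (hU.measure_pos volume hne).ne'
    ((measure_mono hUb).trans_lt (volume_ballSet_lt_top d)).ne

theorem inv_mul_log_mul_exp {V c : ℝ} (hV : 0 < V) {n : ℕ} (hn : n ≠ 0) :
    (n : ℝ)⁻¹ * Real.log (V * Real.exp (n * c)) = (n : ℝ)⁻¹ * Real.log V + c := by
  rw [Real.log_mul hV.ne' (Real.exp_pos _).ne', Real.log_exp]
  field_simp

theorem tendsto_inv_mul_const_add (a c : ℝ) :
    Tendsto (fun n : ℕ => (n : ℝ)⁻¹ * a + c) atTop (𝓝 c) := by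
  simpa using (tendsto_inv_atTop_nhds_zero_nat (𝕜 := ℝ)).mul_const a |>.add_const c

theorem continuousAt_psi {d : ℕ} (β : ℝ) (m s : Fin d → ℝ) {p : (Fin d → ℝ) × (Fin d → ℝ)}
    (hp : p ∈ ballSet d) :
    ContinuousAt (fun q : ((Fin d → ℝ) × (Fin d → ℝ)) × ((Fin d → ℝ) × (Fin d → ℝ)) =>
      psi d β q.1.1 q.1.2 q.2.1 q.2.2) ((m, s), p) := by
  have h : ip p.1 p.1 + ip p.2 p.2 < 1 := hp
  have ht : 1 - ip p.1 p.1 - ip p.2 p.2 ≠ 0 := by linarith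
  have hip (f g : ((Fin d → ℝ) × (Fin d → ℝ)) × ((Fin d → ℝ) × (Fin d → ℝ)) → Fin d → ℝ)
      (hf : Continuous f) (hg : Continuous g) : Continuous fun q => ip (f q) (g q) :=
    continuous_ip.comp (hf.prodMk hg)
  have h1 := hip (fun q => q.2.1) (fun q => q.2.1) (by fun_prop) (by fun_prop)
  have h2 := hip (fun q => q.2.2) (fun q => q.2.2) (by fun_prop) (by fun_prop)
  have h3 := hip (fun q => q.1.1) (fun q => q.2.1) (by fun_prop) (by fun_prop)
  have h4 := hip (fun q => q.1.2) (fun q => q.2.2) (by fun_prop) (by fun_prop)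
  have h5 := ((continuous_const (y := (1 : ℝ))).sub h1 |>.sub h2).continuousAt
    (x := ((m, s), p)) |>.log ht
  unfold psi
  fun_prop

/-- Around each point of the ball, `ψ` is bounded below by nearly its value there, uniformly for
parameters close to the given ones. -/
theorem exists_isOpen_forall_lt_psi {d : ℕ} {β : ℝ} {m s : Fin d → ℝ} {ms : ℕ → Fin d → ℝ}
    {ss : ℕ → Fin d → ℝ} (hm : Tendsto ms atTop (𝓝 m)) (hs : Tendsto ss atTop (𝓝 s))
    {p : (Fin d → ℝ) × (Fin d → ℝ)} (hp : p ∈ ballSet d) {c : ℝ} (hc : c < psi d β m s p.1 p.2) :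
    ∃ U, IsOpen U ∧ p ∈ U ∧ U ⊆ ballSet d ∧
      ∀ᶠ n in atTop, ∀ q ∈ U, c ≤ psi d β (ms n) (ss n) q.1 q.2 := by
  have hev := (continuousAt_psi β m s hp).eventually (lt_mem_nhds hc)
  rw [nhds_prod_eq, eventually_prod_iff] at hev
  obtain ⟨A, hA, B, hB, hAB⟩ := hev
  obtain ⟨U, hUB, hU, hpU⟩ := eventually_nhds_iff.1 hB
  refine ⟨U ∩ ballSet d, hU.inter (isOpen_ballSet d), ⟨hpU, hp⟩, Set.inter_subset_right, ?_⟩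
  filter_upwards [(hm.prodMk_nhds hs).eventually hA] with n hn q hq
  exact (hAB hn (hUB q hq.1)).le

/-- Laplace-method lower bound: liminf (1/n) ln ∫_{B_{2d}(0,1)}
(1-‖x‖²-‖y‖²)^{-(d+1)} e^{n ψₙ} ≥ sup_{B_{2d}(0,1)} ψ. -/
theorem stmt4 (d : ℕ) (hd : 1 ≤ d) (β : ℝ) (hβ : 0 < β) (h : ℕ → Fin d → ℝ)
    (m s : Fin d → ℝ)
    (hm : Tendsto (sampleMean d h) atTop (𝓝 m))
    (hs : Tendsto (sampleStd d h) atTop (𝓝 s))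
    (hspos : ∀ j, 0 < s j) :
    sSup ((fun p : (Fin d → ℝ) × (Fin d → ℝ) => psi d β m s p.1 p.2) '' ballSet d) ≤
      Filter.liminf (fun n : ℕ =>
        (n : ℝ)⁻¹ * Real.log (∫ p in ballSet d,
          Real.exp (n * psi d β (sampleMean d h n) (sampleStd d h n) p.1 p.2) /
            (1 - ip p.1 p.1 - ip p.2 p.2) ^ (d + 1) ∂volume)) atTop := by
  change _ ≤ liminf (fun n : ℕ => (n : ℝ)⁻¹ * Real.log (∫ p in ballSet d,
    tiltedDensity d β (sampleMean d h n) (sampleStd d h n) n p)) atTop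
  have hV := volume_real_pos_of_isOpen_of_subset_ballSet (isOpen_ballSet d)
    ⟨0, zero_mem_ballSet d⟩ subset_rfl
  have lower {p : (Fin d → ℝ) × (Fin d → ℝ)} (hp : p ∈ ballSet d) {c : ℝ}
      (hc : c < psi d β m s p.1 p.2) :
      ∀ᶠ n : ℕ in atTop, 0 < (∫ p in ballSet d,
          tiltedDensity d β (sampleMean d h n) (sampleStd d h n) n p) ∧
        c ≤ (n : ℝ)⁻¹ * Real.log (∫ p in ballSet d,
          tiltedDensity d β (sampleMean d h n) (sampleStd d h n) n p) := by
    obtain ⟨c', hcc', hc'⟩ := exists_between hc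
    obtain ⟨U, hU, hpU, hUb, hψ⟩ := exists_isOpen_forall_lt_psi hm hs hp hc'
    have hVU := volume_real_pos_of_isOpen_of_subset_ballSet hU ⟨p, hpU⟩ hUb
    filter_upwards [hψ, eventually_ge_atTop 4,
      (tendsto_inv_mul_const_add (Real.log (volume.real U)) c').eventually (lt_mem_nhds hcc')]
      with n hn hn4 hlim
    have hint := volume_real_mul_exp_le_integral hd hβ.le _ _ hn4 hU.measurableSet hUb hn
    have hpos : 0 < volume.real U * Real.exp (n * c') := by positivity
    refine ⟨hpos.trans_le hint, ?_⟩
    calc c ≤ (n : ℝ)⁻¹ * Real.log (volume.real U * Real.exp (n * c')) := by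
          rw [inv_mul_log_mul_exp hVU (by omega)]
          exact hlim.le
      _ ≤ _ := by gcongr
  have hcob : IsCoboundedUnder (· ≥ ·) atTop fun n : ℕ => (n : ℝ)⁻¹ * Real.log (∫ p in ballSet d,
      tiltedDensity d β (sampleMean d h n) (sampleStd d h n) n p) := by
    have hK : Tendsto (fun n => β / 2 + β * ∑ j, |sampleMean d h n j| +
        β * ∑ j, |sampleStd d h n j|) atTop
        (𝓝 (β / 2 + β * ∑ j, |m j| + β * ∑ j, |s j|)) := by
      have hm' := tendsto_finsetSum Finset.univ fun j _ => (tendsto_pi_nhds.1 hm j).abs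
      have hs' := tendsto_finsetSum Finset.univ fun j _ => (tendsto_pi_nhds.1 hs j).abs
      exact ((hm'.const_mul β).const_add (β / 2)).add (hs'.const_mul β)
    have hlim := (tendsto_inv_mul_const_add (Real.log (volume.real (ballSet d))) 0).add hK
    refine IsBoundedUnder.isCoboundedUnder_ge (hlim.isBoundedUnder_le.mono_le ?_)
    filter_upwards [eventually_ge_atTop 4,
      lower (zero_mem_ballSet d) (sub_one_lt _)] with n hn4 hpos
    rw [add_zero, ← inv_mul_log_mul_exp hV (by omega)]
    have := hpos.1
    gcongr
    exact integral_tiltedDensity_le hd hβ.le _ _ hn4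
  refine csSup_le ⟨_, 0, zero_mem_ballSet d, rfl⟩ ?_
  rintro _ ⟨p, hp, rfl⟩
  exact le_of_forall_lt_imp_le_of_dense fun c hc =>
    le_liminf_of_le hcob ((lower hp hc).mono fun n hn => hn.2)
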